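/- arXiv:1511.07200 — 9 statements merged into one kernel-verified Lean document; each statement's English description precedes it below -/
import Mathlib

section
/- For every y ∈ ℝ and every x with 0 < x ≤ π, one has φ(x,y) > 0. -/
/-- The auxiliary function of Lemma 3.1: `φ(x,y) = 1 − exp(x·y)·(cos x − y·sin x)`. -/
noncomputable def phi (x y : ℝ) : ℝ :=
  1 - Real.exp (x * y) * (Real.cos x - y * Real.sin x)

theorem hasDerivAt_phi (x y : ℝ) :
    HasDerivAt (fun t => phi t y) (Real.exp (x * y) * ((1 + y ^ 2) * Real.sin x)) x := by
  have hexp : HasDerivAt (fun t : ℝ => Real.exp (t * y)) (Real.exp (x * y) * (1 * y)) x :=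
    ((hasDerivAt_id x).mul_const y).exp
  have htrig : HasDerivAt (fun t : ℝ => Real.cos t - y * Real.sin t)
      (-Real.sin x - y * Real.cos x) x :=
    (Real.hasDerivAt_cos x).sub ((Real.hasDerivAt_sin x).const_mul y)
  exact ((hexp.mul htrig).const_sub 1).congr_deriv (by ring)

theorem strictMonoOn_phi (y : ℝ) : StrictMonoOn (fun t => phi t y) (Set.Icc 0 Real.pi) := by
  refine strictMonoOn_of_deriv_pos (convex_Icc _ _)
    (fun x _ => (hasDerivAt_phi x y).continuousAt.continuousWithinAt) fun x hx => ?_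
  rw [interior_Icc] at hx
  rw [(hasDerivAt_phi x y).deriv]
  have hsin := Real.sin_pos_of_mem_Ioo hx
  positivity

/-- For every `y ∈ ℝ` and every `x` with `0 < x ≤ π`, one has `φ(x,y) > 0`. -/
theorem stmt_1 (y x : ℝ) (hx0 : 0 < x) (hxpi : x ≤ Real.pi) : 0 < phi x y := by
  simpa [phi] using
    strictMonoOn_phi y ⟨le_rfl, Real.pi_pos.le⟩ ⟨hx0.le, hxpi⟩ hx0
end

section
/- For every y < 0 and every x with 0 < x ≤ 2π, one has φ(x,y) > 0. -/
/-- For every `y < 0` and every `x` with `0 < x ≤ 2π`, one has `φ(x,y) > 0`. -/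
theorem stmt_3 (y x : ℝ) (hy : y < 0) (hx0 : 0 < x) (hx2pi : x ≤ 2 * Real.pi) :
    0 < phi x y := by
  have h : Real.cos x - y * Real.sin x < Real.exp (-(x * y)) := by
    nlinarith [Real.cos_le_one x, mul_lt_mul_of_neg_left (Real.sin_lt hx0) hy,
      Real.add_one_le_exp (-(x * y))]
  have h' := mul_lt_mul_of_pos_left h (Real.exp_pos (x * y))
  rw [← Real.exp_add, add_neg_cancel, Real.exp_zero] at h'
  exact sub_pos.mpr h'
end

section
/- If γ > 0, then for every τ ∈ (π, 2π) one has b(τ) > a(τ) (that is, the Poincaré half-return map of an unstable real focus satisfies π₊(a) > a on its parametric domain). -/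
/-- Parametric abscissa of the Poincaré half-return map:
`a(τ) = −(β·exp(−γ·τ)/(d·sin τ))·φ(τ,γ)`. -/
noncomputable def aMap (β d γ τ : ℝ) : ℝ :=
  -(β * Real.exp (-(γ * τ)) / (d * Real.sin τ)) * phi τ γ

/-- Parametric ordinate of the Poincaré half-return map:
`b(τ) = −(β·exp(γ·τ)/(d·sin τ))·φ(τ,−γ)`. -/
noncomputable def bMap (β d γ τ : ℝ) : ℝ :=
  -(β * Real.exp (γ * τ) / (d * Real.sin τ)) * phi τ (-γ)

/-- If `γ > 0`, then for every `τ ∈ (π, 2π)` one has `b(τ) > a(τ)`: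
the Poincaré half-return map of an unstable real focus satisfies `π₊(a) > a`. -/
theorem stmt_6 (β d γ : ℝ) (hβ : 0 < β) (hd : 0 < d) (hγ : 0 < γ)
    (τ : ℝ) (hτ : τ ∈ Set.Ioo Real.pi (2 * Real.pi)) :
    aMap β d γ τ < bMap β d γ τ := by
  obtain ⟨h1, h2⟩ := hτ
  have hs : Real.sin τ < 0 := by
    rw [← Real.sin_sub_two_pi]
    exact Real.sin_neg_of_neg_of_neg_pi_lt (by linarith) (by linarith)
  have hτ0 : 0 < τ := Real.pi_pos.trans h1
  have hexp : Real.exp (-(γ * τ)) < Real.exp (γ * τ) :=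
    Real.exp_lt_exp.2 (by linarith [mul_pos hγ hτ0])
  have hmul : Real.exp (γ * τ) * Real.exp (-(γ * τ)) = 1 := by
    rw [← Real.exp_add, add_neg_cancel, Real.exp_zero]
  have key : bMap β d γ τ - aMap β d γ τ = β / (d * -Real.sin τ) *
      (Real.exp (γ * τ) - Real.exp (-(γ * τ)) + 2 * γ * -Real.sin τ) := by
    unfold aMap bMap phi
    rw [show τ * -γ = -(γ * τ) by ring, mul_comm τ γ, mul_neg d, div_neg]
    linear_combination (2 * β / (d * Real.sin τ) * γ * Real.sin τ) * hmul
  have hpos : 0 < β / (d * -Real.sin τ) *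
      (Real.exp (γ * τ) - Real.exp (-(γ * τ)) + 2 * γ * -Real.sin τ) :=
    mul_pos (div_pos hβ (mul_pos hd (neg_pos.2 hs)))
      (add_pos (sub_pos.2 hexp) (mul_pos (by positivity) (neg_pos.2 hs)))
  linarith
end

section
/- If γ < 0, then for every τ ∈ (π, 2π) one has b(τ) < a(τ) (that is, the Poincaré half-return map of a stable real focus satisfies π₊(a) < a on its parametric domain). -/
/-- If `γ < 0`, then for every `τ ∈ (π, 2π)` one has `b(τ) < a(τ)`:
the Poincaré half-return map of a stable real focus satisfies `π₊(a) < a`. -/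
theorem stmt_7 (β d γ : ℝ) (hβ : 0 < β) (hd : 0 < d) (hγ : γ < 0)
    (τ : ℝ) (hτ : τ ∈ Set.Ioo Real.pi (2 * Real.pi)) :
    bMap β d γ τ < aMap β d γ τ := by
  obtain ⟨h1, h2⟩ := hτ
  have hτ0 : 0 < τ := Real.pi_pos.trans h1
  have hs : Real.sin τ < 0 := by
    have h := Real.sin_neg_of_neg_of_neg_pi_lt (x := τ - 2 * Real.pi) (by linarith) (by linarith)
    rwa [Real.sin_sub_two_pi] at h
  have hγτ : γ * τ < 0 := mul_neg_of_neg_of_pos hγ hτ0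
  have hexp : Real.exp (γ * τ) < Real.exp (-(γ * τ)) := Real.exp_lt_exp.2 (by linarith)
  have hγs : 0 < γ * Real.sin τ := mul_pos_of_neg_of_neg hγ hs
  have hK : 0 < β / (d * -Real.sin τ) := div_pos hβ (mul_pos hd (by linarith))
  have hinv : Real.exp (γ * τ) * Real.exp (-(γ * τ)) = 1 := by
    rw [← Real.exp_add, add_neg_cancel, Real.exp_zero]
  have ha : aMap β d γ τ = β / (d * -Real.sin τ) *
      (Real.exp (-(γ * τ)) - Real.cos τ + γ * Real.sin τ) := by
    rw [aMap, phi, mul_comm τ γ, mul_neg, div_neg]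
    linear_combination (β / (d * Real.sin τ)) * (Real.cos τ - γ * Real.sin τ) * hinv
  have hb : bMap β d γ τ = β / (d * -Real.sin τ) *
      (Real.exp (γ * τ) - Real.cos τ - γ * Real.sin τ) := by
    rw [bMap, phi, mul_neg τ γ, mul_comm τ γ, mul_neg, div_neg]
    linear_combination (β / (d * Real.sin τ)) * (Real.cos τ + γ * Real.sin τ) * hinv
  rw [ha, hb]
  exact mul_lt_mul_of_pos_left (by linarith) hK
end

section
/- At every τ with sin τ ≠ 0, the function a has derivative a′(τ) = −(β/(d·sin²τ))·φ(τ,−γ) and the function b has derivative b′(τ) = −(β/(d·sin²τ))·φ(τ,γ). -/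
/-- Multiplying out the exponential factor of `aMap`. -/
lemma aMap_eq (β d γ τ : ℝ) :
    aMap β d γ τ = -(β / d) *
      ((Real.exp (-(γ * τ)) - Real.cos τ + γ * Real.sin τ) / Real.sin τ) := by
  have h : Real.exp (-(γ * τ)) * Real.exp (τ * γ) = 1 := by
    rw [← Real.exp_add, mul_comm τ γ, neg_add_cancel, Real.exp_zero]
  unfold aMap phi
  linear_combination β / d / Real.sin τ * (Real.cos τ - γ * Real.sin τ) * h

lemma bMap_eq_aMap_neg (β d γ : ℝ) : bMap β d γ = aMap β d (-γ) := by
  funext τ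
  simp [aMap, bMap]

lemma hasDerivAt_aMap (β d γ : ℝ) {τ : ℝ} (hτ : Real.sin τ ≠ 0) :
    HasDerivAt (aMap β d γ) (-(β / (d * Real.sin τ ^ 2)) * phi τ (-γ)) τ := by
  rw [funext (aMap_eq β d γ)]
  have hexp : HasDerivAt (fun t => Real.exp (-(γ * t))) (Real.exp (-(γ * τ)) * -(γ * 1)) τ :=
    ((hasDerivAt_id τ).const_mul γ).neg.exp
  have hnum := (hexp.sub (Real.hasDerivAt_cos τ)).add ((Real.hasDerivAt_sin τ).const_mul γ)
  refine ((hnum.div (Real.hasDerivAt_sin τ) hτ).const_mul (-(β / d))).congr_deriv ?_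
  have hphi : phi τ (-γ) =
      1 - Real.exp (-(γ * τ)) * (Real.cos τ + γ * Real.sin τ) := by
    rw [phi, show τ * -γ = -(γ * τ) by ring]
    ring
  rw [hphi, ← div_div]
  simp only [Pi.add_apply, Pi.sub_apply]
  field_simp
  linear_combination -β / d * Real.sin_sq_add_cos_sq τ

/-- At every `τ` with `sin τ ≠ 0` one has
`a′(τ) = −(β/(d·sin²τ))·φ(τ,−γ)` and `b′(τ) = −(β/(d·sin²τ))·φ(τ,γ)`. -/
theorem stmt_8 (β d γ : ℝ) (τ : ℝ) (hτ : Real.sin τ ≠ 0) :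
    HasDerivAt (aMap β d γ) (-(β / (d * Real.sin τ ^ 2)) * phi τ (-γ)) τ ∧
    HasDerivAt (bMap β d γ) (-(β / (d * Real.sin τ ^ 2)) * phi τ γ) τ := by
  refine ⟨hasDerivAt_aMap β d γ hτ, ?_⟩
  rw [bMap_eq_aMap_neg]
  simpa only [neg_neg] using hasDerivAt_aMap β d (-γ) hτ
end

section
/- As τ → π from the right, both a(τ) and b(τ) tend to +∞; i.e. a and b tend to +∞ along the filter of right-neighborhoods of π. -/
/-- The abscissa blows up to `+∞` as `τ → π⁺`: the factor `-(sin τ)⁻¹` tends to `+∞` and the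
remaining factor has the positive limit `β e^{-γπ} (1 + e^{γπ}) / d`. -/
theorem tendsto_aMap_atTop {β d : ℝ} (γ : ℝ) (hβ : 0 < β) (hd : 0 < d) :
    Filter.Tendsto (aMap β d γ) (nhdsWithin Real.pi (Set.Ioi Real.pi)) Filter.atTop := by
  have hsin : Filter.Tendsto (fun τ => -Real.sin τ) (nhdsWithin Real.pi (Set.Ioi Real.pi))
      (nhdsWithin 0 (Set.Ioi 0)) := by
    refine tendsto_nhdsWithin_iff.2 ⟨?_, ?_⟩
    · have h : Continuous fun τ => -Real.sin τ := by fun_prop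
      simpa using (h.tendsto Real.pi).mono_left nhdsWithin_le_nhds
    · filter_upwards [Ioo_mem_nhdsGT (show Real.pi < 2 * Real.pi by linarith [Real.pi_pos])]
        with τ hτ
      have h := Real.sin_pos_of_pos_of_lt_pi (x := τ - Real.pi) (by linarith [hτ.1])
        (by linarith [hτ.2])
      rwa [Real.sin_sub_pi] at h
  have hfac : Filter.Tendsto (fun τ => β * Real.exp (-(γ * τ)) / d * phi τ γ)
      (nhdsWithin Real.pi (Set.Ioi Real.pi))
      (nhds (β * Real.exp (-(γ * Real.pi)) / d * phi Real.pi γ)) := by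
    have h : Continuous fun τ => β * Real.exp (-(γ * τ)) / d * phi τ γ := by
      unfold phi
      fun_prop
    exact (h.tendsto Real.pi).mono_left nhdsWithin_le_nhds
  have hphi : 0 < phi Real.pi γ := by
    simp only [phi, Real.cos_pi, Real.sin_pi]
    linarith [Real.exp_pos (Real.pi * γ)]
  refine ((tendsto_inv_nhdsGT_zero.comp hsin).atTop_mul_pos (by positivity) hfac).congr
    fun τ => ?_
  simp only [aMap, Function.comp_apply, inv_neg, div_eq_mul_inv, mul_inv]
  ring

/-- As `τ → π⁺`, both `a(τ)` and `b(τ)` tend to `+∞`. -/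
theorem stmt_9 (β d γ : ℝ) (hβ : 0 < β) (hd : 0 < d) :
    Filter.Tendsto (aMap β d γ) (nhdsWithin Real.pi (Set.Ioi Real.pi)) Filter.atTop ∧
    Filter.Tendsto (bMap β d γ) (nhdsWithin Real.pi (Set.Ioi Real.pi)) Filter.atTop := by
  refine ⟨tendsto_aMap_atTop γ hβ hd, ?_⟩
  have h : bMap β d γ = aMap β d (-γ) := by
    funext τ
    simp [aMap, bMap]
  exact h ▸ tendsto_aMap_atTop (-γ) hβ hd
end

section
/- As τ → π from the right, the quotient b(τ)/a(τ) tends to exp(γ·π). (Equivalently, lim_{a→∞} π₊(a)/a = e^{γπ}.) -/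
theorem continuous_phi_left (y : ℝ) : Continuous fun x => phi x y := by
  unfold phi
  fun_prop

theorem phi_pi (y : ℝ) : phi Real.pi y = 1 + Real.exp (Real.pi * y) := by
  simp [phi]

theorem bMap_div_aMap {β d τ : ℝ} (γ : ℝ) (hβ : β ≠ 0) (hd : d ≠ 0) (hτ : Real.sin τ ≠ 0) :
    bMap β d γ τ / aMap β d γ τ = Real.exp (2 * (γ * τ)) * (phi τ (-γ) / phi τ γ) := by
  have hc : -(β * Real.exp (γ * τ) / (d * Real.sin τ)) =
      Real.exp (2 * (γ * τ)) * -(β * Real.exp (-(γ * τ)) / (d * Real.sin τ)) := by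
    have he : Real.exp (γ * τ) = Real.exp (2 * (γ * τ)) * Real.exp (-(γ * τ)) := by
      rw [← Real.exp_add]
      ring_nf
    rw [he]
    ring
  have hne : -(β * Real.exp (-(γ * τ)) / (d * Real.sin τ)) ≠ 0 :=
    neg_ne_zero.2 (div_ne_zero (mul_ne_zero hβ (Real.exp_ne_zero _)) (mul_ne_zero hd hτ))
  rw [bMap, aMap, hc, mul_div_mul_comm, mul_div_cancel_right₀ _ hne]

/-- As `τ → π⁺`, the quotient `b(τ)/a(τ)` tends to `exp(γ·π)`. -/
theorem stmt_10 (β d γ : ℝ) (hβ : 0 < β) (hd : 0 < d) :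
    Filter.Tendsto (fun τ => bMap β d γ τ / aMap β d γ τ)
      (nhdsWithin Real.pi (Set.Ioi Real.pi)) (nhds (Real.exp (γ * Real.pi))) := by
  have hpos : (0 : ℝ) < 1 + Real.exp (Real.pi * γ) := by positivity
  have hcont : ContinuousAt (fun τ => Real.exp (2 * (γ * τ)) * (phi τ (-γ) / phi τ γ)) Real.pi :=
    ContinuousAt.mul (by fun_prop) ((continuous_phi_left (-γ)).continuousAt.div
      (continuous_phi_left γ).continuousAt (by rw [phi_pi]; exact hpos.ne'))
  have hval : Real.exp (2 * (γ * Real.pi)) * (phi Real.pi (-γ) / phi Real.pi γ) =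
      Real.exp (γ * Real.pi) := by
    rw [phi_pi, phi_pi, ← mul_div_assoc, div_eq_iff hpos.ne', mul_add, mul_add, ← Real.exp_add,
      ← Real.exp_add]
    ring_nf
  have hlim := hcont.tendsto.mono_left (nhdsWithin_le_nhds (s := Set.Ioi Real.pi))
  rw [hval] at hlim
  refine hlim.congr' ?_
  have hmem : Set.Ioo Real.pi (2 * Real.pi) ∈ nhdsWithin Real.pi (Set.Ioi Real.pi) :=
    Ioo_mem_nhdsGT (by linarith [Real.pi_pos])
  filter_upwards [hmem] with τ hτ
  have hsin : Real.sin τ ≠ 0 := by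
    have h := Real.sin_pos_of_pos_of_lt_pi (sub_pos.2 hτ.1) (by linarith [hτ.2])
    rw [Real.sin_sub_pi] at h
    exact (neg_pos.1 h).ne
  exact (bMap_div_aMap γ hβ.ne' hd.ne' hsin).symm
end

section
/- As τ → π from the right, the difference b(τ) − exp(γ·π)·a(τ) tends to (2·γ·β/d)·(1 + exp(γ·π)). (Equivalently, the straight line b = e^{γπ}·a + t·(1+e^{γπ})/d, with trace t = 2γβ, is an asymptote of the graph of the Poincaré half-return map π₊.) -/
open Filter Topology in
/-- L'Hôpital's rule at a common zero, in the form that only uses the derivatives at that point. -/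
theorem HasDerivAt.tendsto_div_of_eq_zero {f g : ℝ → ℝ} {f' g' x : ℝ}
    (hf : HasDerivAt f f' x) (hg : HasDerivAt g g' x) (hfx : f x = 0) (hgx : g x = 0)
    (hg' : g' ≠ 0) : Tendsto (fun y => f y / g y) (𝓝[≠] x) (𝓝 (f' / g')) := by
  refine ((hasDerivAt_iff_tendsto_slope.1 hf).div (hasDerivAt_iff_tendsto_slope.1 hg) hg').congr' ?_
  filter_upwards [self_mem_nhdsWithin] with y hy
  have hyx : y - x ≠ 0 := sub_ne_zero.2 hy
  simp only [Pi.div_apply, slope_def_field, hfx, hgx, sub_zero]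
  exact div_div_div_cancel_right₀ hyx _ _

theorem bMap_eq (β d γ τ : ℝ) :
    bMap β d γ τ = -(β / d) *
      ((Real.exp (γ * τ) - Real.cos τ - γ * Real.sin τ) / Real.sin τ) := by
  have h : Real.exp (γ * τ) * Real.exp (τ * -γ) = 1 := by
    rw [← Real.exp_add]; simp [mul_comm]
  simp only [bMap, phi, div_eq_mul_inv, mul_inv]
  linear_combination β * d⁻¹ * (Real.sin τ)⁻¹ * (Real.cos τ + γ * Real.sin τ) * h

theorem aMap_eq_bMap_neg (β d γ τ : ℝ) : aMap β d γ τ = bMap β d (-γ) τ := by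
  simp [aMap, bMap]

/-- As `τ → π⁺`, the difference `b(τ) − exp(γ·π)·a(τ)` tends to
`(2·γ·β/d)·(1 + exp(γ·π))`: the line `b = e^{γπ}·a + t·(1+e^{γπ})/d`, with trace
`t = 2γβ`, is an asymptote of the graph of the Poincaré half-return map. -/
theorem stmt_11 (β d γ : ℝ) (hβ : 0 < β) (hd : 0 < d) :
    Filter.Tendsto (fun τ => bMap β d γ τ - Real.exp (γ * Real.pi) * aMap β d γ τ)
      (nhdsWithin Real.pi (Set.Ioi Real.pi))
      (nhds (2 * γ * β / d * (1 + Real.exp (γ * Real.pi)))) := by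
  set E := Real.exp (γ * Real.pi) with hE
  have hE_inv : E * Real.exp (-γ * Real.pi) = 1 := by
    rw [hE, ← Real.exp_add]; simp
  have hderiv (c : ℝ) : HasDerivAt
      (fun τ => Real.exp (c * τ) - Real.cos τ - c * Real.sin τ)
      (c * Real.exp (c * Real.pi) + c) Real.pi := by
    have h := (((hasDerivAt_id Real.pi).const_mul c).exp.sub
      (Real.hasDerivAt_cos Real.pi)).sub ((Real.hasDerivAt_sin Real.pi).const_mul c)
    refine h.congr_deriv ?_
    simp only [id_eq, Real.cos_pi, Real.sin_pi]
    ring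
  have hlim := (HasDerivAt.tendsto_div_of_eq_zero ((hderiv γ).sub ((hderiv (-γ)).const_mul E))
    (Real.hasDerivAt_sin Real.pi)
    (by simp only [Pi.sub_apply, Real.cos_pi, Real.sin_pi]; linear_combination -hE_inv)
    Real.sin_pi (by simp)).const_mul (-(β / d))
  have hle : nhdsWithin Real.pi (Set.Ioi Real.pi) ≤ nhdsWithin Real.pi {Real.pi}ᶜ :=
    nhdsWithin_mono _ fun τ hτ => ne_of_gt hτ
  convert hlim.mono_left hle using 2
  · simp only [aMap_eq_bMap_neg, bMap_eq, Pi.sub_apply]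
    ring
  · rw [Real.cos_pi, ← hE]
    linear_combination -(β / d * γ) * hE_inv
end

section
/- Let a₁ ∈ (−2,2) with a₁ ≠ 0, set α = a₁/2, β = √(1−α²), γ = α/β and τ_o = arccos α. Suppose s : ℝ → ℝ is differentiable at −1, satisfies s(−1) = τ_o/β, and satisfies the flight-time equation (b₂ − 1)·e^{α·s(b₂)}·( cos(β·s(b₂)) − γ·sin(β·s(b₂)) ) = b₂ + 1 for all b₂ in some neighborhood of −1. Then s′(−1) = (1/2)·e^{−γ·τ_o}. -/
/-- Let `a₁ ∈ (−2,2)`, `a₁ ≠ 0`, `α = a₁/2`, `β = √(1−α²)`, `γ = α/β`,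
`τ_o = arccos α`. If `s` is differentiable at `−1`, `s(−1) = τ_o/β`, and
`(b₂ − 1)·e^{α·s(b₂)}·(cos(β·s(b₂)) − γ·sin(β·s(b₂))) = b₂ + 1` for all `b₂` in a
neighborhood of `−1`, then `s′(−1) = (1/2)·e^{−γ·τ_o}`. -/
theorem stmt_19 (a₁ : ℝ) (ha : a₁ ∈ Set.Ioo (-2 : ℝ) 2) (ha0 : a₁ ≠ 0)
    (α β γ τo : ℝ) (hα : α = a₁ / 2) (hβ : β = Real.sqrt (1 - α ^ 2))
    (hγ : γ = α / β) (hτ : τo = Real.arccos α)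
    (s : ℝ → ℝ) (hdiff : DifferentiableAt ℝ s (-1)) (hs1 : s (-1) = τo / β)
    (heq : ∀ᶠ b₂ in nhds (-1 : ℝ),
      (b₂ - 1) * Real.exp (α * s b₂) *
        (Real.cos (β * s b₂) - γ * Real.sin (β * s b₂)) = b₂ + 1) :
    deriv s (-1) = (1 / 2) * Real.exp (-(γ * τo)) := by
  obtain ⟨h1, h2⟩ := ha
  have hlt : 0 < 1 - α ^ 2 := by
    subst hα
    nlinarith
  have hβpos : 0 < β := hβ ▸ Real.sqrt_pos.mpr hlt
  have hβsq : β ^ 2 = 1 - α ^ 2 := by rw [hβ, Real.sq_sqrt hlt.le]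
  have hcos : Real.cos τo = α := by
    rw [hτ, Real.cos_arccos] <;> linarith
  have hsin : Real.sin τo = β := by rw [hτ, Real.sin_arccos, hβ]
  have hγβ : γ * β = α := by rw [hγ, div_mul_cancel₀ _ hβpos.ne']
  have hβs : β * s (-1) = τo := by rw [hs1, mul_div_cancel₀ _ hβpos.ne']
  have hαs : α * s (-1) = γ * τo := by rw [← hγβ, mul_assoc, hβs]
  have hs := hdiff.hasDerivAt
  have hl := (((hasDerivAt_id (-1 : ℝ)).sub_const 1).mul (hs.const_mul α).exp).mul
    ((hs.const_mul β).cos.sub ((hs.const_mul β).sin.const_mul γ))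
  have hr := ((hasDerivAt_id (-1 : ℝ)).add_const 1).congr_of_eventuallyEq heq
  have key := hl.unique hr
  simp only [Pi.mul_apply, Pi.sub_apply, id_eq, hβs, hαs, hcos, hsin] at key
  have hmain : 2 * Real.exp (γ * τo) * deriv s (-1) = 1 := by
    linear_combination key - 2 * Real.exp (γ * τo) * deriv s (-1) * hβsq +
      Real.exp (γ * τo) * (1 - 4 * α * deriv s (-1)) * hγβ
  rw [Real.exp_neg]
  field_simp
  linarith
end
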